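/- arXiv:2305.19816 — 2 statements merged into one kernel-verified Lean document; each statement's English description precedes it below -/
import Mathlib

section
/- Let p be a prime, n ≥ 1, and q = p^n with q > 3 (i.e. (p, n) ≠ (2, 1), (3, 1)). Let S = SL_2(F_q) be the special linear group of degree 2 over the field with q elements, and let R be a Sylow p-subgroup of S. Then: (a) if H is a proper subgroup of S with R ≤ H, then H is contained in the normalizer N_S(R); (b) if Q is a Sylow p-subgroup of S with Q ≠ R, then Q ∩ R = 1. -/
open Matrix MatrixGroups MulAction

namespace Matrix.SpecialLinearGroup

variable {F : Type*} [Field F]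

lemma mem_stabilizer_single_zero_iff (g : SL(2, F)) :
    g ∈ stabilizer SL(2, F) (Pi.single 0 1 : Fin 2 → F) ↔
      ∃ b, g = transvection (zero_ne_one (α := Fin 2)) b := by
  refine ⟨fun hg ↦ ⟨g 0 1, ?_⟩, ?_⟩
  · rw [mem_stabilizer_iff, SpecialLinearGroup.smul_def, smul_eq_mulVec, mulVec_single_one] at hg
    have h0 : g 0 0 = 1 := by simpa using congrFun hg 0
    have h1 : g 1 0 = 0 := by simpa using congrFun hg 1
    have hdet := g.det_coe
    rw [det_fin_two, h0, h1] at hdet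
    ext i j
    fin_cases i <;> fin_cases j <;> simp [transvection_coe, h0, h1]
    simpa using hdet
  · rintro ⟨b, rfl⟩
    exact transvection_smul_single_fst _ b

lemma exists_smul_single_zero {v : Fin 2 → F} (hv : v ≠ 0) :
    ∃ g : SL(2, F), g • (Pi.single 0 1 : Fin 2 → F) = v := by
  have hcop : IsCoprime (v 0) (v 1) := by
    by_cases h0 : v 0 = 0
    · have h1 : v 1 ≠ 0 := fun h1 ↦ hv <| by
        ext i
        fin_cases i <;> simp [h0, h1]
      exact ⟨0, (v 1)⁻¹, by simp [h1]⟩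
    · exact ⟨(v 0)⁻¹, 0, by simp [h0]⟩
  obtain ⟨g, h0, h1⟩ := hcop.exists_SL2_col 0
  refine ⟨g, ?_⟩
  rw [SpecialLinearGroup.smul_def, smul_eq_mulVec, mulVec_single_one]
  ext i
  fin_cases i <;> simp [h0, h1]

lemma transvection_pow {ι : Type*} [DecidableEq ι] [Fintype ι] {i j : ι} (hij : i ≠ j) (b : F)
    (k : ℕ) : transvection hij b ^ k = transvection hij (k * b) := by
  induction k with
  | zero => simp
  | succ k ih => rw [pow_succ, ih, ← transvection_add, Nat.cast_succ, add_mul, one_mul]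

lemma isPGroup_stabilizer (p : ℕ) [CharP F p] {v : Fin 2 → F} (hv : v ≠ 0) :
    IsPGroup p (stabilizer SL(2, F) v) := by
  obtain ⟨g, rfl⟩ := exists_smul_single_zero hv
  rw [stabilizer_smul_eq_stabilizer_map_conj]
  refine IsPGroup.map ?_ _
  rintro ⟨x, hx⟩
  obtain ⟨b, rfl⟩ := (mem_stabilizer_single_zero_iff x).1 hx
  refine ⟨1, Subtype.ext ?_⟩
  simp [transvection_pow]

lemma exists_sylow_eq_stabilizer [Finite F] (p : ℕ) [Fact p.Prime] [CharP F p]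
    (R : Sylow p SL(2, F)) :
    ∃ v : Fin 2 → F, v ≠ 0 ∧ (R : Subgroup SL(2, F)) = stabilizer SL(2, F) v := by
  have hcard : p ∣ Nat.card (Fin 2 → F) := by
    have : p ∣ Nat.card F := by
      have := Fintype.ofFinite F
      rw [Nat.card_eq_fintype_card, ← CharP.cast_eq_zero_iff F p]
      exact Nat.cast_card_eq_zero F
    rw [Nat.card_fun]
    exact dvd_pow this (by simp)
  obtain ⟨v, hv, hne⟩ := R.isPGroup'.exists_fixed_point_of_prime_dvd_card_of_fixed_point
    (Fin 2 → F) hcard (a := 0) fun g ↦ smul_zero g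
  exact ⟨v, hne.symm, (R.is_maximal' (isPGroup_stabilizer p hne.symm) fun g hg ↦ hv ⟨g, hg⟩).symm⟩

lemma stabilizer_smul_of_ne_zero {c : F} (hc : c ≠ 0) (v : Fin 2 → F) :
    stabilizer SL(2, F) (c • v) = stabilizer SL(2, F) v := by
  ext g
  rw [mem_stabilizer_iff, mem_stabilizer_iff, smul_comm g c v]
  exact (smul_right_injective _ hc).eq_iff

lemma stabilizer_inf_stabilizer_eq_bot {v w : Fin 2 → F} (hv : v ≠ 0) (hw : w ≠ 0)
    (h : stabilizer SL(2, F) v ≠ stabilizer SL(2, F) w) :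
    stabilizer SL(2, F) v ⊓ stabilizer SL(2, F) w = ⊥ := by
  obtain ⟨g, rfl⟩ := exists_smul_single_zero hv
  obtain ⟨w, rfl⟩ : ∃ w', g • w' = w := ⟨g⁻¹ • w, smul_inv_smul g w⟩
  rw [stabilizer_smul_eq_stabilizer_map_conj, stabilizer_smul_eq_stabilizer_map_conj] at *
  rw [← Subgroup.map_inf _ _ _ (MulAut.conj g).injective, Subgroup.map_eq_bot_iff_of_injective _
    (MulAut.conj g).injective, eq_bot_iff]
  have hw1 : w 1 ≠ 0 := by
    intro hw1
    have hw' : w = w 0 • (Pi.single 0 1 : Fin 2 → F) := by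
      ext i
      fin_cases i <;> simp [hw1]
    have hw0 : w 0 ≠ 0 := by
      intro hw0
      rw [hw', hw0] at hw
      simp at hw
    rw [hw', stabilizer_smul_of_ne_zero hw0] at h
    exact h rfl
  rintro x ⟨hx, hxw⟩
  obtain ⟨b, rfl⟩ := (mem_stabilizer_single_zero_iff x).1 hx
  have := congrFun (mem_stabilizer_iff.1 hxw) 0
  have hb : b = 0 := by
    simpa [SpecialLinearGroup.smul_def, transvection_coe, add_mulVec, single_mulVec_eq, hw1]
      using this
  simp [hb]

lemma eq_top_of_stabilizer_single_zero_le {K : Subgroup SL(2, F)}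
    (hK : stabilizer SL(2, F) (Pi.single 0 1 : Fin 2 → F) ≤ K) {k : SL(2, F)} (hk : k ∈ K)
    (hk10 : k 1 0 ≠ 0) : K = ⊤ := by
  have upper (b : F) : transvection (zero_ne_one (α := Fin 2)) b ∈ K :=
    hK ((mem_stabilizer_single_zero_iff _).2 ⟨b, rfl⟩)
  have lower (b : F) : transvection (one_ne_zero (α := Fin 2)) b ∈ K := by
    set m := transvection (zero_ne_one (α := Fin 2)) (-(k 0 0 / k 1 0)) * k *
      transvection (zero_ne_one (α := Fin 2)) (-(k 1 1 / k 1 0)) with hm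
    have hmK : m ∈ K := K.mul_mem (K.mul_mem (upper _) hk) (upper _)
    have hconj : transvection (one_ne_zero (α := Fin 2)) b =
        m * transvection (zero_ne_one (α := Fin 2)) (-(b / k 1 0 ^ 2)) * m⁻¹ := by
      rw [eq_mul_inv_iff_mul_eq]
      have hdet := k.det_coe
      rw [det_fin_two] at hdet
      ext i j
      fin_cases i <;> fin_cases j <;>
        simp [hm, transvection_coe, mul_apply, Fin.sum_univ_two] <;> field_simp <;> grind
    rw [hconj]
    exact K.mul_mem (K.mul_mem hmK (upper _)) (K.inv_mem hmK)
  refine eq_top_iff.2 fun g _ ↦ SL2.transvection_induction (· ∈ K) (fun i j hij c ↦ ?_)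
    (fun _ _ ↦ K.mul_mem) g
  fin_cases i <;> fin_cases j
  · exact absurd rfl hij
  · exact upper c
  · exact lower c
  · exact absurd rfl hij

lemma smul_single_zero_of_apply_one_zero_eq_zero {k : SL(2, F)} (hk : k 1 0 = 0) :
    k • (Pi.single 0 1 : Fin 2 → F) = k 0 0 • (Pi.single 0 1 : Fin 2 → F) := by
  rw [SpecialLinearGroup.smul_def, smul_eq_mulVec, mulVec_single_one]
  ext i
  fin_cases i <;> simp [hk]

lemma le_normalizer_stabilizer {v : Fin 2 → F} (hv : v ≠ 0) {H : Subgroup SL(2, F)}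
    (hvH : stabilizer SL(2, F) v ≤ H) (hH : H ≠ ⊤) :
    H ≤ Subgroup.normalizer (stabilizer SL(2, F) v : Set SL(2, F)) := by
  obtain ⟨g, rfl⟩ := exists_smul_single_zero hv
  intro h hh
  have h10 : (g⁻¹ * h * g) 1 0 = 0 := by
    by_contra h10
    refine hH ?_
    have htop : H.comap (MulAut.conj g).toMonoidHom = ⊤ := by
      refine eq_top_of_stabilizer_single_zero_le ?_ ?_ h10
      · rwa [← Subgroup.map_le_iff_le_comap, ← stabilizer_smul_eq_stabilizer_map_conj]
      · simpa [mul_assoc] using hh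
    have hsurj : Function.Surjective (MulAut.conj g).toMonoidHom := (MulAut.conj g).surjective
    rw [← Subgroup.map_comap_eq_self_of_surjective hsurj H, htop,
      Subgroup.map_top_of_surjective _ hsurj]
  have hsmul : h • g • (Pi.single 0 1 : Fin 2 → F) =
      (g⁻¹ * h * g) 0 0 • g • (Pi.single 0 1 : Fin 2 → F) := by
    rw [← smul_comm g ((g⁻¹ * h * g) 0 0), ← inv_smul_eq_iff, smul_smul, smul_smul,
      smul_single_zero_of_apply_one_zero_eq_zero h10]
  have h00 : (g⁻¹ * h * g) 0 0 ≠ 0 := by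
    intro h00
    rw [h00, zero_smul, smul_eq_zero_iff_eq] at hsmul
    exact hv hsmul
  rw [Subgroup.mem_normalizer_iff_map_conj_eq]
  refine (stabilizer_smul_eq_stabilizer_map_conj h _).symm.trans ?_
  rw [hsmul, stabilizer_smul_of_ne_zero h00]

end Matrix.SpecialLinearGroup

/-- Lemma 4.1 of the paper for `S = SL₂(q)`, `q = pⁿ > 3`. If `R` is a Sylow
`p`-subgroup of `S`, then (a) any proper subgroup of `S` containing `R` is contained
in the normalizer of `R`, and (b) two distinct Sylow `p`-subgroups of `S` intersect
trivially. Here `F` is the field with `q = pⁿ` elements. -/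
theorem sl2_sylow_lemma (p n : ℕ) (hp : p.Prime) (hn : 1 ≤ n)
    (F : Type*) [Field F] [Fintype F] (hF : Fintype.card F = p ^ n) (hq : 3 < p ^ n)
    (R : Sylow p (Matrix.SpecialLinearGroup (Fin 2) F)) :
    (∀ H : Subgroup (Matrix.SpecialLinearGroup (Fin 2) F),
      (R : Subgroup (Matrix.SpecialLinearGroup (Fin 2) F)) ≤ H → H ≠ ⊤ →
      H ≤ Subgroup.normalizer ((R : Subgroup (Matrix.SpecialLinearGroup (Fin 2) F)) :
         Set (Matrix.SpecialLinearGroup (Fin 2) F))) ∧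
    (∀ Q : Sylow p (Matrix.SpecialLinearGroup (Fin 2) F), Q ≠ R →
      (Q : Subgroup (Matrix.SpecialLinearGroup (Fin 2) F)) ⊓
        (R : Subgroup (Matrix.SpecialLinearGroup (Fin 2) F)) = ⊥) := by
  have : Fact p.Prime := ⟨hp⟩
  have : CharP F p := charP_of_card_eq_prime_pow (f := n) (by rw [hF])
  obtain ⟨v, hv, hR⟩ := Matrix.SpecialLinearGroup.exists_sylow_eq_stabilizer p R
  refine ⟨fun H hRH hH ↦ ?_, fun Q hQR ↦ ?_⟩
  · rw [hR] at hRH ⊢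
    exact Matrix.SpecialLinearGroup.le_normalizer_stabilizer hv hRH hH
  · obtain ⟨w, hw, hQ⟩ := Matrix.SpecialLinearGroup.exists_sylow_eq_stabilizer p Q
    have hne : (Q : Subgroup (Matrix.SpecialLinearGroup (Fin 2) F)) ≠ R := fun h ↦ hQR (Sylow.ext h)
    rw [hQ, hR] at hne ⊢
    exact Matrix.SpecialLinearGroup.stabilizer_inf_stabilizer_eq_bot hw hv hne
end

section
/- Let p be a prime, n ≥ 1, and q = p^n with q > 3 (i.e. (p, n) ≠ (2, 1), (3, 1)). Let S = PSL_2(F_q), the quotient of SL_2(F_q) by its center, and let R be a Sylow p-subgroup of S. Then: (a) if H is a proper subgroup of S with R ≤ H, then H is contained in the normalizer N_S(R); (b) if Q is a Sylow p-subgroup of S with Q ≠ R, then Q ∩ R = 1. -/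
/-- `PSL₂(F)`: the quotient of `SL₂(F)` by its center. -/
abbrev PSL2 (F : Type*) [Field F] [Fintype F] :=
  Matrix.SpecialLinearGroup (Fin 2) F ⧸
    Subgroup.center (Matrix.SpecialLinearGroup (Fin 2) F)

namespace PSL2

open Matrix Matrix.SpecialLinearGroup

variable {F : Type*} [Field F]

lemma mul_entry (a b : SpecialLinearGroup (Fin 2) F) (i j : Fin 2) :
    (a * b) i j = a i 0 * b 0 j + a i 1 * b 1 j := by
  rw [coe_mul, Matrix.mul_apply, Fin.sum_univ_two]

lemma inv_entries (g : SpecialLinearGroup (Fin 2) F) :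
    g⁻¹ 0 0 = g 1 1 ∧ g⁻¹ 0 1 = -g 0 1 ∧ g⁻¹ 1 0 = -g 1 0 ∧ g⁻¹ 1 1 = g 0 0 := by
  simp [coe_inv, Matrix.adjugate_fin_two]

lemma mem_center_iff_entries {g : SpecialLinearGroup (Fin 2) F} :
    g ∈ Subgroup.center (SpecialLinearGroup (Fin 2) F) ↔
      g 1 0 = 0 ∧ g 0 1 = 0 ∧ g 0 0 = g 1 1 := by
  rw [Matrix.SpecialLinearGroup.mem_center_iff]
  constructor
  · rintro ⟨r, -, hr⟩
    have h (i j) : g i j = Matrix.scalar (Fin 2) r i j := by rw [hr]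
    simp [h]
  · rintro ⟨h10, h01, h⟩
    have hdet := g.det_coe
    rw [Matrix.det_fin_two, h10, h01, ← h] at hdet
    refine ⟨g 0 0, by simp [← hdet, sq], ?_⟩
    ext i j
    fin_cases i <;> fin_cases j <;> simp [h10, h01, h]

lemma det_entries (g : SpecialLinearGroup (Fin 2) F) :
    g 0 0 * g 1 1 - g 0 1 * g 1 0 = 1 := by
  rw [← Matrix.det_fin_two, g.det_coe]

/-- The preimage in `SL₂(F)` of the group of unipotent upper triangular elements of `PSL₂(F)`:
upper triangular matrices with equal diagonal entries. -/
def unipotent (F : Type*) [Field F] : Subgroup (SpecialLinearGroup (Fin 2) F) where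
  carrier := {g | g 1 0 = 0 ∧ g 0 0 = g 1 1}
  one_mem' := by simp
  mul_mem' := by
    rintro a b ⟨ha, ha'⟩ ⟨hb, hb'⟩
    constructor <;> simp [mul_entry, ha, ha', hb, hb']
  inv_mem' := by
    rintro a ⟨ha, ha'⟩
    obtain ⟨h00, -, h10, h11⟩ := inv_entries a
    exact ⟨by simp [h10, ha], by rw [h00, h11, ha']⟩

lemma mem_unipotent {g : SpecialLinearGroup (Fin 2) F} :
    g ∈ unipotent F ↔ g 1 0 = 0 ∧ g 0 0 = g 1 1 := Iff.rfl

lemma center_le_unipotent :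
    Subgroup.center (SpecialLinearGroup (Fin 2) F) ≤ unipotent F := fun _ hg =>
  let h := mem_center_iff_entries.1 hg
  ⟨h.1, h.2.2⟩

/-- A subgroup of `SL₂(F)` containing the unipotent upper triangular matrices is either upper
triangular or everything. -/
lemma eq_top_of_unipotent_le {K : Subgroup (SpecialLinearGroup (Fin 2) F)}
    (hK : unipotent F ≤ K) {g : SpecialLinearGroup (Fin 2) F} (hg : g ∈ K) (hc : g 1 0 ≠ 0) :
    K = ⊤ := by
  let u (t : F) : SpecialLinearGroup (Fin 2) F := ⟨!![1, t; 0, 1], by simp⟩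
  let l (t : F) : SpecialLinearGroup (Fin 2) F := ⟨!![1, 0; t, 1], by simp⟩
  have hu (t : F) : u t ∈ K := hK ⟨rfl, rfl⟩
  let w : SpecialLinearGroup (Fin 2) F := ⟨!![0, -(g 1 0)⁻¹; g 1 0, 0], by simp [hc]⟩
  have hdet := det_entries g
  have hw : w ∈ K := by
    have h : w = u (-(g 0 0 / g 1 0)) * g * u (-(g 1 1 / g 1 0)) := by
      ext i j
      rw [mul_entry, mul_entry, mul_entry]
      fin_cases i <;> fin_cases j <;>
        simp [w, u] <;> field_simp <;> grind
    rw [h]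
    exact mul_mem (mul_mem (hu _) hg) (hu _)
  have hl (t : F) : l t ∈ K := by
    have h : l t = w * u (-t / g 1 0 ^ 2) * w⁻¹ := by
      rw [eq_mul_inv_iff_mul_eq]
      ext i j
      rw [mul_entry, mul_entry]
      fin_cases i <;> fin_cases j <;>
        simp [w, u, l] <;> field_simp
    rw [h]
    exact mul_mem (mul_mem hw (hu _)) (inv_mem hw)
  have key (x : SpecialLinearGroup (Fin 2) F) (hx : x 1 0 ≠ 0) : x ∈ K := by
    have hdet := det_entries x
    have h : x = u ((x 0 0 - 1) / x 1 0) * l (x 1 0) * u ((x 1 1 - 1) / x 1 0) := by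
      ext i j
      rw [mul_entry, mul_entry, mul_entry]
      fin_cases i <;> fin_cases j <;>
        simp [u, l] <;> field_simp <;> grind
    rw [h]
    exact mul_mem (mul_mem (hu _) (hl _)) (hu _)
  refine (Subgroup.eq_top_iff' K).2 fun x => ?_
  by_cases hx : x 1 0 = 0
  · have hdet := det_entries x
    have hx0 : x 0 0 ≠ 0 := by
      intro h
      simp [h, hx] at hdet
    refine (Subgroup.mul_mem_cancel_left K (hl 1)).1 (key _ ?_)
    rw [mul_entry]
    simpa [l, hx] using hx0
  · exact key x hx

lemma conj_mem_unipotent {g x : SpecialLinearGroup (Fin 2) F} (hg : g 1 0 = 0)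
    (hx : x ∈ unipotent F) : g * x * g⁻¹ ∈ unipotent F := by
  obtain ⟨h, h'⟩ := hx
  obtain ⟨i00, i01, i10, i11⟩ := inv_entries g
  rw [mem_unipotent]
  simp only [mul_entry, i00, i01, i10, i11, hg, h, h']
  constructor <;> ring

/-- An element conjugating a noncentral unipotent upper triangular matrix to an upper triangular
matrix is itself upper triangular. -/
lemma lower_left_eq_zero_of_conj_mem {g x : SpecialLinearGroup (Fin 2) F}
    (hx : x ∈ unipotent F) (hxc : x ∉ Subgroup.center (SpecialLinearGroup (Fin 2) F))
    (h : g * x * g⁻¹ ∈ unipotent F) : g 1 0 = 0 := by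
  obtain ⟨h10, hd⟩ := hx
  have h01 : x 0 1 ≠ 0 := fun h01 => hxc (mem_center_iff_entries.2 ⟨h10, h01, hd⟩)
  have := h.1
  obtain ⟨i00, -, i10, -⟩ := inv_entries g
  simp only [mul_entry, i00, i10, h10, hd] at this
  grind

lemma pow_entries {g : SpecialLinearGroup (Fin 2) F} (hg : g 1 0 = 0) (m : ℕ) :
    (g ^ m) 1 0 = 0 ∧ (g ^ m) 0 0 = g 0 0 ^ m ∧ (g ^ m) 1 1 = g 1 1 ^ m := by
  induction m with
  | zero => simp
  | succ m ih =>
    obtain ⟨h, h0, h1⟩ := ih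
    rw [pow_succ]
    simp only [mul_entry, h, h0, h1, hg]
    simp [pow_succ]

lemma pow_upper_right {g : SpecialLinearGroup (Fin 2) F} (hg : g ∈ unipotent F) (m : ℕ) :
    g 0 0 * (g ^ m) 0 1 = m * g 0 0 ^ m * g 0 1 := by
  induction m with
  | zero => simp
  | succ m ih =>
    have h0 := (pow_entries hg.1 m).2.1
    rw [pow_succ]
    simp only [mul_entry, h0, ← hg.2, mul_add]
    push_cast
    linear_combination g 0 0 * ih

lemma pow_char_mem_center (p : ℕ) [CharP F p] {g : SpecialLinearGroup (Fin 2) F}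
    (hg : g ∈ unipotent F) : g ^ p ∈ Subgroup.center (SpecialLinearGroup (Fin 2) F) := by
  obtain ⟨h, h0, h1⟩ := pow_entries hg.1 p
  have hdet := det_entries g
  have ha : g 0 0 ≠ 0 := by
    intro h
    simp [h, hg.1] at hdet
  have h01 := pow_upper_right hg p
  rw [CharP.cast_eq_zero F p, zero_mul, zero_mul] at h01
  exact mem_center_iff_entries.2
    ⟨h, (mul_eq_zero.1 h01).resolve_left ha, by rw [h0, h1, hg.2]⟩

lemma mem_unipotent_of_pow_mem_center (p k : ℕ) [Fact p.Prime] [CharP F p]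
    {g : SpecialLinearGroup (Fin 2) F} (hg : g 1 0 = 0)
    (h : g ^ p ^ k ∈ Subgroup.center (SpecialLinearGroup (Fin 2) F)) : g ∈ unipotent F := by
  obtain ⟨-, h0, h1⟩ := pow_entries hg (p ^ k)
  have hd := (mem_center_iff_entries.1 h).2.2
  rw [h0, h1] at hd
  exact ⟨hg, iterateFrobenius_inj F p k (by simpa [iterateFrobenius_def] using hd)⟩

variable [Fintype F]

/-- The subgroup of unipotent upper triangular elements of `PSL₂(F)`. -/
def unipotentSubgroup (F : Type*) [Field F] [Fintype F] : Subgroup (PSL2 F) :=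
  (unipotent F).map (QuotientGroup.mk' _)

lemma mk_mem_unipotentSubgroup {g : SpecialLinearGroup (Fin 2) F} :
    (g : PSL2 F) ∈ unipotentSubgroup F ↔ g ∈ unipotent F := by
  have h : (unipotentSubgroup F).comap (QuotientGroup.mk' _) = unipotent F :=
    Subgroup.comap_map_eq_self (by simpa using center_le_unipotent)
  rw [← h]
  rfl

lemma isPGroup_unipotentSubgroup (p : ℕ) [CharP F p] :
    IsPGroup p (unipotentSubgroup F) := by
  rintro ⟨x, hx⟩
  induction x using QuotientGroup.induction_on with | H g => ?_
  refine ⟨1, Subtype.ext ?_⟩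
  have := pow_char_mem_center p (mk_mem_unipotentSubgroup.1 hx)
  simpa using (QuotientGroup.eq_one_iff _).2 this

/-- A subgroup of `PSL₂(F)` containing the unipotent upper triangular elements and an element
that is not upper triangular is everything. -/
lemma eq_top_of_unipotentSubgroup_le {H : Subgroup (PSL2 F)} (hH : unipotentSubgroup F ≤ H)
    {g : SpecialLinearGroup (Fin 2) F} (hg : (g : PSL2 F) ∈ H) (hc : g 1 0 ≠ 0) : H = ⊤ := by
  have hK : H.comap (QuotientGroup.mk' _) = ⊤ :=
    eq_top_of_unipotent_le (fun x hx => hH (mk_mem_unipotentSubgroup.2 hx)) hg hc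
  refine (Subgroup.eq_top_iff' H).2 fun x => ?_
  induction x using QuotientGroup.induction_on with | H x => ?_
  have : x ∈ H.comap (QuotientGroup.mk' _) := hK ▸ Subgroup.mem_top x
  exact this

lemma exists_sq_ne_one (hF : 3 < Fintype.card F) : ∃ a : F, a ≠ 0 ∧ a ^ 2 ≠ 1 := by
  classical
  by_contra! h
  have hsub : (Finset.univ : Finset F) ⊆ {0, 1, -1} := fun a _ => by
    by_cases ha : a = 0
    · simp [ha]
    · simpa [ha] using h a ha
  have := (Finset.card_le_card hsub).trans Finset.card_le_three
  rw [Finset.card_univ] at this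
  omega

/-- The unipotent upper triangular elements form a Sylow `p`-subgroup of `PSL₂(F)`. -/
lemma exists_sylow_eq_unipotentSubgroup (p : ℕ) [Fact p.Prime] [CharP F p]
    (hF : 3 < Fintype.card F) : ∃ P : Sylow p (PSL2 F), (P : Subgroup (PSL2 F)) =
      unipotentSubgroup F := by
  obtain ⟨P, hP⟩ := (isPGroup_unipotentSubgroup (F := F) p).exists_le_sylow
  have key {g : SpecialLinearGroup (Fin 2) F} (hg : (g : PSL2 F) ∈ P) (hc : g 1 0 = 0) :
      g ∈ unipotent F := by
    obtain ⟨k, hk⟩ := P.isPGroup' ⟨g, hg⟩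
    refine mem_unipotent_of_pow_mem_center p k hc ((QuotientGroup.eq_one_iff _).1 ?_)
    simpa using congrArg Subtype.val hk
  refine ⟨P, le_antisymm (fun x hx => ?_) hP⟩
  induction x using QuotientGroup.induction_on with | H g => ?_
  refine mk_mem_unipotentSubgroup.2 (key hx ?_)
  by_contra hc
  have htop := eq_top_of_unipotentSubgroup_le hP hx hc
  obtain ⟨a, ha, ha2⟩ := exists_sq_ne_one hF
  let d : SpecialLinearGroup (Fin 2) F := ⟨!![a, 0; 0, a⁻¹], by simp [ha]⟩
  have hd : (d : PSL2 F) ∈ (P : Subgroup (PSL2 F)) := htop ▸ Subgroup.mem_top _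
  have := (key hd (by simp [d])).2
  simp only [d, Matrix.of_apply, Matrix.cons_val', Matrix.cons_val_zero, Matrix.cons_val_one,
    Matrix.cons_val_fin_one] at this
  apply ha2
  field_simp at this
  exact this

lemma smul_eq_of_lower_left_eq_zero {p : ℕ} [Fact p.Prime] {P : Sylow p (PSL2 F)}
    (hP : (P : Subgroup (PSL2 F)) = unipotentSubgroup F)
    {g : SpecialLinearGroup (Fin 2) F} (hg : g 1 0 = 0) : (g : PSL2 F) • P = P := by
  rw [Sylow.smul_eq_iff_mem_normalizer, ← P.coe_coe, hP, Subgroup.mem_normalizer_iff]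
  intro x
  induction x using QuotientGroup.induction_on with | H x => ?_
  rw [← QuotientGroup.mk_inv, ← QuotientGroup.mk_mul, ← QuotientGroup.mk_mul,
    mk_mem_unipotentSubgroup, mk_mem_unipotentSubgroup]
  refine ⟨conj_mem_unipotent hg, fun h => ?_⟩
  have hg' : (g⁻¹) 1 0 = 0 := by simp [(inv_entries g).2.2.1, hg]
  have := conj_mem_unipotent hg' h
  group at this
  simpa using this

lemma mem_smul_sylow_iff {G : Type*} [Group G] {p : ℕ} {g x : G} {P : Sylow p G} :
    x ∈ ((g • P : Sylow p G) : Subgroup G) ↔ g⁻¹ * x * g ∈ (P : Subgroup G) := by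
  rw [Sylow.smul_def, Sylow.pointwise_smul_def, Subgroup.mem_pointwise_smul_iff_inv_smul_mem,
    ← map_inv, MulAut.smul_def, MulAut.conj_apply, inv_inv]

end PSL2

/-- Lemma 4.1 of the paper for `S = PSL₂(q)`, `q = pⁿ > 3`. If `R` is a Sylow
`p`-subgroup of `S`, then (a) any proper subgroup of `S` containing `R` is contained
in the normalizer of `R`, and (b) two distinct Sylow `p`-subgroups of `S` intersect
trivially. Here `F` is the field with `q = pⁿ` elements. -/
theorem psl2_sylow_lemma (p n : ℕ) (hp : p.Prime) (hn : 1 ≤ n)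
    (F : Type*) [Field F] [Fintype F] (hF : Fintype.card F = p ^ n) (hq : 3 < p ^ n)
    (R : Sylow p (PSL2 F)) :
    (∀ H : Subgroup (PSL2 F),
      (R : Subgroup (PSL2 F)) ≤ H → H ≠ ⊤ → H ≤ Subgroup.normalizer ((R : Subgroup (PSL2 F)) : Set (PSL2 F))) ∧
    (∀ Q : Sylow p (PSL2 F), Q ≠ R →
      (Q : Subgroup (PSL2 F)) ⊓ (R : Subgroup (PSL2 F)) = ⊥) := by
  have : Fact p.Prime := ⟨hp⟩
  have : CharP F p := charP_of_card_eq_prime_pow hF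
  obtain ⟨P, hP⟩ := PSL2.exists_sylow_eq_unipotentSubgroup (F := F) p (hF ▸ hq)
  obtain ⟨r, rfl⟩ := MulAction.exists_smul_eq (PSL2 F) P R
  refine ⟨fun H hRH hH h hh => ?_, fun Q hQ => ?_⟩
  · refine Sylow.smul_eq_iff_mem_normalizer.1 ?_
    rw [smul_smul, ← inv_smul_eq_iff, smul_smul, ← mul_assoc]
    let H' : Subgroup (PSL2 F) := H.comap (MulAut.conj r).toMonoidHom
    have hPH : PSL2.unipotentSubgroup F ≤ H' := fun x hx =>
      hRH (PSL2.mem_smul_sylow_iff.2 (by simpa [hP, mul_assoc] using hx))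
    have hmem : r⁻¹ * h * r ∈ H' := by simpa [H', mul_assoc] using hh
    have hH' : H' ≠ ⊤ := fun htop => hH <| (Subgroup.eq_top_iff' H).2 fun x => by
      have : r⁻¹ * x * r ∈ H' := htop ▸ Subgroup.mem_top _
      simpa [H', mul_assoc] using this
    obtain ⟨g, hg⟩ := QuotientGroup.mk_surjective (r⁻¹ * h * r)
    rw [← hg] at hmem ⊢
    refine PSL2.smul_eq_of_lower_left_eq_zero hP ?_
    by_contra hc
    exact hH' (PSL2.eq_top_of_unipotentSubgroup_le hPH hmem hc)
  · obtain ⟨s, rfl⟩ := MulAction.exists_smul_eq (PSL2 F) P Q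
    rw [Subgroup.eq_bot_iff_forall]
    rintro x ⟨hxs, hxr⟩
    by_contra hx
    apply hQ
    have hxs := PSL2.mem_smul_sylow_iff.1 hxs
    have hxr := PSL2.mem_smul_sylow_iff.1 hxr
    obtain ⟨g, hg⟩ := QuotientGroup.mk_surjective (s⁻¹ * r)
    obtain ⟨y, hy⟩ := QuotientGroup.mk_surjective (r⁻¹ * x * r)
    have hyx : s⁻¹ * x * s = ((g * y * g⁻¹ : Matrix.SpecialLinearGroup (Fin 2) F) : PSL2 F) := by
      rw [QuotientGroup.mk_mul, QuotientGroup.mk_mul, QuotientGroup.mk_inv, hg, hy]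
      group
    rw [hP, ← hy, PSL2.mk_mem_unipotentSubgroup] at hxr
    rw [hP, hyx, PSL2.mk_mem_unipotentSubgroup] at hxs
    have hyc : y ∉ Subgroup.center (Matrix.SpecialLinearGroup (Fin 2) F) := fun hyc => hx <| by
      rw [(QuotientGroup.eq_one_iff y).2 hyc] at hy
      simpa [eq_comm, mul_assoc, inv_mul_eq_one, mul_eq_right, eq_inv_mul_iff_mul_eq] using hy
    have hg0 := PSL2.lower_left_eq_zero_of_conj_mem hxr hyc hxs
    have := PSL2.smul_eq_of_lower_left_eq_zero hP hg0
    rw [hg, mul_smul, inv_smul_eq_iff] at this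
    exact this.symm
end
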